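/- arXiv:2403.05977 — 2 statements merged into one kernel-verified Lean document; each statement's English description precedes it below -/
import Mathlib

section
/- Let P and P̃ be real symmetric n×n matrices and let Δ̂ be a real symmetric n×n matrix with nonnegative entries such that |P̃ i j − P i j| ≤ Δ̂ i j for all i, j. Define P̂ = P̃ + diag(Δ̂·1), where diag(Δ̂·1) is the diagonal matrix whose (i,i) entry is Σ_j Δ̂ i j. Then P̂ − P is positive semidefinite, i.e., P̂ ⪰ P is a conservative upper bound on P. -/
/-- Conservativeness of the bound `P̂ = P̃ + diag(Δ̂·1)`: `P̂ - P` is PSD. -/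
theorem bound_is_conservative {n : ℕ} (P Ptilde Δhat : Matrix (Fin n) (Fin n) ℝ)
    (hP : P.IsSymm) (hPt : Ptilde.IsSymm) (hΔs : Δhat.IsSymm)
    (hΔnn : ∀ i j, 0 ≤ Δhat i j)
    (hbound : ∀ i j, |Ptilde i j - P i j| ≤ Δhat i j) :
    (Ptilde + Matrix.diagonal (fun k => ∑ l, Δhat k l) - P).PosSemidef := by
  refine .of_dotProduct_mulVec_nonneg ?_ (fun x ↦ ?_)
  · change Matrix.conjTranspose _ = _
    rw [Matrix.conjTranspose_eq_transpose_of_trivial]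
    exact (hPt.add (Matrix.isSymm_diagonal _)).sub hP
  · have hS : star x ⬝ᵥ ((Ptilde + Matrix.diagonal (fun k => ∑ l, Δhat k l) - P).mulVec x)
        = ∑ i, ∑ j, ((Ptilde i j - P i j) * x i * x j + Δhat i j * x i ^ 2) := by
      rw [Matrix.sub_mulVec, Matrix.add_mulVec]
      simp only [dotProduct, Pi.sub_apply, Pi.add_apply, Matrix.mulVec_diagonal, Pi.star_apply,
        star_trivial]
      refine Finset.sum_congr rfl fun i _ => ?_
      simp only [Matrix.mulVec, dotProduct]
      rw [Finset.sum_mul, ← Finset.sum_add_distrib, ← Finset.sum_sub_distrib, Finset.mul_sum]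
      refine Finset.sum_congr rfl fun j _ => ?_
      ring
    have hswap : ∑ i, ∑ j, Δhat i j * x i ^ 2 = ∑ i, ∑ j, Δhat i j * x j ^ 2 := by
      rw [Finset.sum_comm]
      refine Finset.sum_congr rfl fun i _ => Finset.sum_congr rfl fun j _ => ?_
      rw [hΔs.apply]
    have hpos : 0 ≤ ∑ i, ∑ j, (2 * ((Ptilde i j - P i j) * x i * x j)
        + Δhat i j * x i ^ 2 + Δhat i j * x j ^ 2) := by
      refine Finset.sum_nonneg fun i _ => Finset.sum_nonneg fun j _ => ?_
      obtain ⟨h1, h2⟩ := abs_le.mp (hbound i j)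
      nlinarith [mul_nonneg (sub_nonneg.2 h2) (sq_nonneg (x i - x j)),
        mul_nonneg (neg_le_iff_add_nonneg.1 h1) (sq_nonneg (x i + x j))]
    rw [hS]
    simp only [Finset.sum_add_distrib, ← Finset.mul_sum] at hpos hswap ⊢
    linarith
end

section
/- Worst-case error bound for a not-triggered transmission step: Let P and P̃ be real symmetric n×n matrices and T a real symmetric n×n matrix with nonnegative entries such that |P̃ i j − P i j| ≤ T i j for all i, j (no element was transmitted and the buffer deviation is bounded by the absolute-change thresholds). Define P̂ = P̃ + diag(T·1), where diag(T·1) is the diagonal matrix with (i,i) entry Σ_j T i j. Then P̂ − P is positive semidefinite, and for every matrix W with entries in {0,1}, ‖W ⊙ (P̂ − P)‖_F ≤ ‖W ⊙ (diag(T·1) + T)‖_F. -/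
/-- Worst-case (no element transmitted) guarantee for the absolute-change trigger:
the bound `P̂ = P̃ + diag(T·1)` is conservative and its error is bounded in
Frobenius norm by `‖W ⊙ (diag(T·1) + T)‖_F`. -/
theorem worst_case_not_triggered {n : ℕ} (P Ptilde T : Matrix (Fin n) (Fin n) ℝ)
    (hP : P.IsSymm) (hPt : Ptilde.IsSymm) (hT : T.IsSymm)
    (hTnn : ∀ i j, 0 ≤ T i j)
    (hbound : ∀ i j, |Ptilde i j - P i j| ≤ T i j) :
    (Ptilde + Matrix.diagonal (fun k => ∑ l, T k l) - P).PosSemidef ∧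
    ∀ W : Matrix (Fin n) (Fin n) ℝ, (∀ i j, W i j = 0 ∨ W i j = 1) →
      Real.sqrt (∑ i, ∑ j,
          (W i j * ((Ptilde + Matrix.diagonal (fun k => ∑ l, T k l) - P) i j)) ^ 2) ≤
      Real.sqrt (∑ i, ∑ j,
          (W i j * ((Matrix.diagonal (fun k => ∑ l, T k l) + T) i j)) ^ 2) := by
  have hD : ∀ i j, |Matrix.diagonal (fun k => ∑ l, T k l) i j + (Ptilde i j - P i j)| ≤
      Matrix.diagonal (fun k => ∑ l, T k l) i j + T i j := by
    intro i j
    have h0 : 0 ≤ Matrix.diagonal (fun k => ∑ l, T k l) i j := by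
      rw [Matrix.diagonal_apply]
      split_ifs
      · exact Finset.sum_nonneg fun l _ => hTnn i l
      · exact le_rfl
    have h1 := abs_le.1 (hbound i j)
    exact abs_le.2 ⟨by linarith [h1.1], by linarith [h1.2]⟩
  refine ⟨?_, ?_⟩
  · refine Matrix.PosSemidef.of_dotProduct_mulVec_nonneg ?_ ?_
    · ext i j
      have h1 := hP.apply i j
      have h2 := hPt.apply i j
      have h3 := (Matrix.isSymm_diagonal (fun k => ∑ l, T k l)).apply i j
      simp only [Matrix.conjTranspose_apply, Matrix.sub_apply, Matrix.add_apply, star_trivial]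
      rw [h1, h2, h3]
    · intro x
      have hA : star x ⬝ᵥ ((Ptilde + Matrix.diagonal (fun k => ∑ l, T k l) - P).mulVec x) =
          (∑ i, ∑ j, (Ptilde i j - P i j) * (x i * x j)) + ∑ i, ∑ j, T i j * x i ^ 2 := by
        have : Ptilde + Matrix.diagonal (fun k => ∑ l, T k l) - P =
          (Ptilde - P) + Matrix.diagonal (fun k => ∑ l, T k l) := by abel
        rw [this, Matrix.add_mulVec, dotProduct_add]
        congr 1
        · simp only [dotProduct, Matrix.mulVec, Finset.mul_sum, Matrix.sub_apply, star_trivial]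
          refine Finset.sum_congr rfl fun i _ => Finset.sum_congr rfl fun j _ => ?_
          ring
        · simp only [dotProduct, Matrix.mulVec_diagonal, star_trivial]
          refine Finset.sum_congr rfl fun i _ => ?_
          rw [← Finset.sum_mul]
          ring
      have hB : ∑ i, ∑ j, T i j * x i ^ 2 = ∑ i, ∑ j, T i j * x j ^ 2 := by
        rw [Finset.sum_comm]
        refine Finset.sum_congr rfl fun i _ => Finset.sum_congr rfl fun j _ => ?_
        rw [hT.apply]
      have hC : 0 ≤ ∑ i, ∑ j, (2 * ((Ptilde i j - P i j) * (x i * x j)) +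
          T i j * x i ^ 2 + T i j * x j ^ 2) := by
        refine Finset.sum_nonneg fun i _ => Finset.sum_nonneg fun j _ => ?_
        have h1 := abs_le.1 (hbound i j)
        nlinarith [mul_nonneg (by linarith [h1.1] : 0 ≤ T i j + (Ptilde i j - P i j))
            (sq_nonneg (x i + x j)),
          mul_nonneg (by linarith [h1.2] : 0 ≤ T i j - (Ptilde i j - P i j))
            (sq_nonneg (x i - x j))]
      simp only [Finset.sum_add_distrib, ← Finset.mul_sum] at hC hA hB
      rw [hA]
      linarith
  · intro W _
    refine Real.sqrt_le_sqrt (Finset.sum_le_sum fun i _ => Finset.sum_le_sum fun j _ => ?_)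
    rw [mul_pow, mul_pow]
    refine mul_le_mul_of_nonneg_left ?_ (sq_nonneg _)
    have h := hD i j
    simp only [Matrix.sub_apply, Matrix.add_apply]
    refine sq_le_sq.2 (le_trans ?_ (le_abs_self _))
    rw [show Ptilde i j + Matrix.diagonal (fun k => ∑ l, T k l) i j - P i j =
      Matrix.diagonal (fun k => ∑ l, T k l) i j + (Ptilde i j - P i j) by ring]
    exact h
end
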